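/- Let v ∈ ℝⁿ be a fixed vector not depending on x. For each i ∈ [d²] and j₀ ∈ [n], ∂⟨f(x)_{j₀} ∘ 𝖠_{j₀,i}, v⟩/∂x_i = ⟨f(x)_{j₀} ∘ 𝖠_{j₀,i} ∘ 𝖠_{j₀,i}, v⟩ − ⟨f(x)_{j₀} ∘ 𝖠_{j₀,i}, v⟩ · ⟨f(x)_{j₀}, 𝖠_{j₀,i}⟩. -/

import Mathlib

open Matrix
open scoped Kronecker

/-- The `j₀`-th `n × d²` block of the Kronecker product `𝖠 = A₁ ⊗ A₂ ∈ ℝ^{n² × d²}`,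
with columns indexed by pairs in `Fin d × Fin d`. -/
noncomputable def Ablock {n d : ℕ} (A₁ A₂ : Matrix (Fin n) (Fin d) ℝ) (j₀ : Fin n) :
    Matrix (Fin n) (Fin d × Fin d) ℝ :=
  Matrix.of fun j p => (A₁ ⊗ₖ A₂) (j₀, j) p

/-- The `i`-th column `𝖠_{j₀,i} ∈ ℝⁿ` of the block `𝖠_{j₀}`. -/
noncomputable def Acol {n d : ℕ} (A₁ A₂ : Matrix (Fin n) (Fin d) ℝ) (j₀ : Fin n)
    (i : Fin d × Fin d) : Fin n → ℝ :=
  fun j => Ablock A₁ A₂ j₀ j i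

/-- `u(x)_{j₀} := exp(𝖠_{j₀} x)` (entrywise exponential). -/
noncomputable def uvec {n d : ℕ} (A₁ A₂ : Matrix (Fin n) (Fin d) ℝ) (j₀ : Fin n)
    (x : Fin d × Fin d → ℝ) : Fin n → ℝ :=
  fun j => Real.exp ((Ablock A₁ A₂ j₀).mulVec x j)

/-- `α(x)_{j₀} := ⟨u(x)_{j₀}, 1ₙ⟩`. -/
noncomputable def alphaS {n d : ℕ} (A₁ A₂ : Matrix (Fin n) (Fin d) ℝ) (j₀ : Fin n)
    (x : Fin d × Fin d → ℝ) : ℝ :=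
  uvec A₁ A₂ j₀ x ⬝ᵥ (fun _ => (1 : ℝ))

/-- `f(x)_{j₀} := α(x)_{j₀}⁻¹ • u(x)_{j₀}`. -/
noncomputable def fvec {n d : ℕ} (A₁ A₂ : Matrix (Fin n) (Fin d) ℝ) (j₀ : Fin n)
    (x : Fin d × Fin d → ℝ) : Fin n → ℝ :=
  (alphaS A₁ A₂ j₀ x)⁻¹ • uvec A₁ A₂ j₀ x

theorem hasFDerivAt_uvec_apply {n d : ℕ} (A₁ A₂ : Matrix (Fin n) (Fin d) ℝ) (j₀ : Fin n)
    (x : Fin d × Fin d → ℝ) (j : Fin n) :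
    HasFDerivAt (fun z => uvec A₁ A₂ j₀ z j)
      (uvec A₁ A₂ j₀ x j •
        ∑ p, Ablock A₁ A₂ j₀ j p • ContinuousLinearMap.proj (R := ℝ) (φ := fun _ => ℝ) p) x := by
  refine HasFDerivAt.exp (f := fun z => (Ablock A₁ A₂ j₀).mulVec z j) ?_
  exact HasFDerivAt.fun_sum fun p _ => (hasFDerivAt_apply p x).const_mul _

theorem hasLineDerivAt_uvec_apply {n d : ℕ} (A₁ A₂ : Matrix (Fin n) (Fin d) ℝ) (j₀ : Fin n)
    (x : Fin d × Fin d → ℝ) (i : Fin d × Fin d) (j : Fin n) :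
    HasLineDerivAt ℝ (fun z => uvec A₁ A₂ j₀ z j)
      (uvec A₁ A₂ j₀ x j * Acol A₁ A₂ j₀ i j) x (Pi.single i 1) := by
  refine HasDerivAt.congr_deriv
    ((hasFDerivAt_uvec_apply A₁ A₂ j₀ x j).hasLineDerivAt (Pi.single i 1)) ?_
  simp [Acol, Pi.single_apply]

theorem alphaS_eq_sum {n d : ℕ} (A₁ A₂ : Matrix (Fin n) (Fin d) ℝ) (j₀ : Fin n)
    (x : Fin d × Fin d → ℝ) : alphaS A₁ A₂ j₀ x = ∑ j, uvec A₁ A₂ j₀ x j := by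
  simp [alphaS, dotProduct]

theorem alphaS_ne_zero {n d : ℕ} (A₁ A₂ : Matrix (Fin n) (Fin d) ℝ) (j₀ : Fin n)
    (x : Fin d × Fin d → ℝ) : alphaS A₁ A₂ j₀ x ≠ 0 := by
  rw [alphaS_eq_sum]
  exact (Finset.sum_pos (fun j _ => Real.exp_pos _) ⟨j₀, Finset.mem_univ j₀⟩).ne'

theorem differentiableAt_fvec_apply {n d : ℕ} (A₁ A₂ : Matrix (Fin n) (Fin d) ℝ) (j₀ : Fin n)
    (x : Fin d × Fin d → ℝ) (j : Fin n) :
    DifferentiableAt ℝ (fun z => fvec A₁ A₂ j₀ z j) x := by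
  have hu k := (hasFDerivAt_uvec_apply A₁ A₂ j₀ x k).differentiableAt
  have hα : DifferentiableAt ℝ (alphaS A₁ A₂ j₀) x := by
    simp_rw [funext (alphaS_eq_sum A₁ A₂ j₀)]
    exact DifferentiableAt.fun_sum fun k _ => hu k
  exact (hα.inv (alphaS_ne_zero A₁ A₂ j₀ x)).mul (hu j)

/-- The softmax derivative `∂f(x)_{j₀} / ∂xᵢ = f ∘ 𝖠_{j₀,i} - ⟨f, 𝖠_{j₀,i}⟩ f`, entrywise. -/
theorem hasLineDerivAt_fvec_apply {n d : ℕ} (A₁ A₂ : Matrix (Fin n) (Fin d) ℝ) (j₀ : Fin n)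
    (x : Fin d × Fin d → ℝ) (i : Fin d × Fin d) (j : Fin n) :
    HasLineDerivAt ℝ (fun z => fvec A₁ A₂ j₀ z j)
      (fvec A₁ A₂ j₀ x j * Acol A₁ A₂ j₀ i j
        - fvec A₁ A₂ j₀ x j * (fvec A₁ A₂ j₀ x ⬝ᵥ Acol A₁ A₂ j₀ i)) x (Pi.single i 1) := by
  have hu k : HasDerivAt (fun t : ℝ => uvec A₁ A₂ j₀ (x + t • Pi.single i 1) k) _ 0 :=
    hasLineDerivAt_uvec_apply A₁ A₂ j₀ x i k
  have hα : HasDerivAt (fun t : ℝ => alphaS A₁ A₂ j₀ (x + t • Pi.single i 1))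
      (uvec A₁ A₂ j₀ x ⬝ᵥ Acol A₁ A₂ j₀ i) 0 := by
    simp_rw [alphaS_eq_sum]
    exact HasDerivAt.fun_sum fun k _ => hu k
  have h0 : alphaS A₁ A₂ j₀ (x + (0 : ℝ) • Pi.single i 1) ≠ 0 :=
    alphaS_ne_zero A₁ A₂ j₀ _
  have hα0 := alphaS_ne_zero A₁ A₂ j₀ x
  refine ((hα.inv h0).mul (hu j)).congr_deriv ?_
  simp only [fvec, Pi.inv_apply, zero_smul, add_zero, smul_dotProduct, Pi.smul_apply, smul_eq_mul]
  field_simp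
  ring

/-- For a fixed vector `v ∈ ℝⁿ` not depending on `x`, for each `i ∈ [d²]`
and `j₀ ∈ [n]`,
`∂⟨f(x)_{j₀} ∘ 𝖠_{j₀,i}, v⟩/∂x_i
  = ⟨f(x)_{j₀} ∘ 𝖠_{j₀,i} ∘ 𝖠_{j₀,i}, v⟩ − ⟨f(x)_{j₀} ∘ 𝖠_{j₀,i}, v⟩·⟨f(x)_{j₀}, 𝖠_{j₀,i}⟩`. -/
theorem gradient_inner_f_circ_A_v_diag {n d : ℕ} (A₁ A₂ : Matrix (Fin n) (Fin d) ℝ)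
    (j₀ : Fin n) (v : Fin n → ℝ) (x : Fin d × Fin d → ℝ) (i : Fin d × Fin d) :
    fderiv ℝ (fun z => (fvec A₁ A₂ j₀ z * Acol A₁ A₂ j₀ i) ⬝ᵥ v) x (Pi.single i 1)
      = (fvec A₁ A₂ j₀ x * Acol A₁ A₂ j₀ i * Acol A₁ A₂ j₀ i) ⬝ᵥ v
        - ((fvec A₁ A₂ j₀ x * Acol A₁ A₂ j₀ i) ⬝ᵥ v)
            * (fvec A₁ A₂ j₀ x ⬝ᵥ Acol A₁ A₂ j₀ i) := by
  have hdiff : DifferentiableAt ℝ (fun z => (fvec A₁ A₂ j₀ z * Acol A₁ A₂ j₀ i) ⬝ᵥ v) x :=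
    DifferentiableAt.fun_sum fun j _ =>
      ((differentiableAt_fvec_apply A₁ A₂ j₀ x j).mul_const _).mul_const _
  have hline : HasLineDerivAt ℝ (fun z => (fvec A₁ A₂ j₀ z * Acol A₁ A₂ j₀ i) ⬝ᵥ v)
      (∑ j, (fvec A₁ A₂ j₀ x j * Acol A₁ A₂ j₀ i j
        - fvec A₁ A₂ j₀ x j * (fvec A₁ A₂ j₀ x ⬝ᵥ Acol A₁ A₂ j₀ i))
          * Acol A₁ A₂ j₀ i j * v j) x (Pi.single i 1) :=
    HasDerivAt.fun_sum fun j _ =>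
      (HasDerivAt.mul_const (hasLineDerivAt_fvec_apply A₁ A₂ j₀ x i j) _).mul_const _
  rw [← hdiff.lineDeriv_eq_fderiv, hline.lineDeriv]
  generalize fvec A₁ A₂ j₀ x ⬝ᵥ Acol A₁ A₂ j₀ i = c
  simp only [dotProduct, Pi.mul_apply, Finset.sum_mul, ← Finset.sum_sub_distrib]
  exact Finset.sum_congr rfl fun j _ => by ring
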